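/- Let ε, μ : ℝ³ → ℝ be continuous up to the boundary of Π with ε > 0 and μ > 0 on the closure of Π, and let λ ∈ ℝ. Let u, v : ℝ³ → ℂ³ be C¹ up to the boundary with compact axial support, satisfying on Π the eigenvalue equations curl u = iλ·μ·v and curl v = −iλ·ε·u, and suppose u = ⟨u, ν⟩·ν on ∂Π (the tangential component of u vanishes). Then for every f : ℝ³ → ℂ³ that is C¹ up to the boundary, one has ∫_Π ε⁻¹·⟨curl v, curl f⟩ dx = λ²·∫_Π μ·⟨v, f⟩ dx. -/

import Mathlib

noncomputable section

open MeasureTheory Real Complex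

/-- Points of `ℝ³`. -/
abbrev V3 := Fin 3 → ℝ
/-- Vectors of `ℂ³`. -/
abbrev C3 := Fin 3 → ℂ

/-- Partial derivative `∂ⱼ` of a complex scalar function on `ℝ³`. -/
def pd (j : Fin 3) (f : V3 → ℂ) (x : V3) : ℂ := fderiv ℝ f x (Pi.single j 1)

/-- Partial derivative `∂ⱼ` of a real scalar function on `ℝ³`. -/
def pdR (j : Fin 3) (f : V3 → ℝ) (x : V3) : ℝ := fderiv ℝ f x (Pi.single j 1)

/-- Partial derivative `∂ⱼ` of a vector field, taken componentwise. -/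
def pdV (j : Fin 3) (a : V3 → C3) (x : V3) : C3 := fun i => pd j (fun y => a y i) x

/-- curl a = (∂₂a₃ − ∂₃a₂, ∂₃a₁ − ∂₁a₃, ∂₁a₂ − ∂₂a₁)  (indices 0,1,2). -/
def vcurl (a : V3 → C3) (x : V3) : C3 :=
  ![pd 1 (fun y => a y 2) x - pd 2 (fun y => a y 1) x,
    pd 2 (fun y => a y 0) x - pd 0 (fun y => a y 2) x,
    pd 0 (fun y => a y 1) x - pd 1 (fun y => a y 0) x]

/-- div a = ∂₁a₁ + ∂₂a₂ + ∂₃a₃. -/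
def vdiv (a : V3 → C3) (x : V3) : ℂ := ∑ j, pd j (fun y => a y j) x

/-- The bilinear (unconjugated) cross product on ℂ³. -/
def cross (a b : C3) : C3 :=
  ![a 1 * b 2 - a 2 * b 1, a 2 * b 0 - a 0 * b 2, a 0 * b 1 - a 1 * b 0]

/-- The Hermitian inner product ⟨a, b⟩ = Σⱼ aⱼ · conj(bⱼ). -/
def hinner (a b : C3) : ℂ := ∑ j, a j * (starRingEnd ℂ) (b j)

/-- The gradient of a real function, viewed as a complex vector. -/
def gradC (g : V3 → ℝ) (x : V3) : C3 := fun j => (pdR j g x : ℂ)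

/-- The Laplacian Δg = ∂₁²g + ∂₂²g + ∂₃²g of a real function. -/
def lapR (g : V3 → ℝ) (x : V3) : ℝ := ∑ j, pdR j (fun y => pdR j g y) x

/-- The solid infinite circular cylinder Π of radius `R`. -/
def Cyl (R : ℝ) : Set V3 := {x | x 0 ^ 2 + x 1 ^ 2 < R ^ 2}

/-- The boundary ∂Π of the cylinder. -/
def bCyl (R : ℝ) : Set V3 := {x | x 0 ^ 2 + x 1 ^ 2 = R ^ 2}

/-- The outward unit normal of the cylinder at a boundary point. -/
def nuR (R : ℝ) (x : V3) : V3 := ![x 0 / R, x 1 / R, 0]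

/-- The outward unit normal, viewed as a complex vector. -/
def nuC (R : ℝ) (x : V3) : C3 := fun j => (nuR R x j : ℂ)

/-- The normal component ⟨z, ν⟩ of z ∈ ℂ³ at a boundary point of the cylinder. -/
def ncomp (R : ℝ) (x : V3) (z : C3) : ℂ := ∑ k, z k * (nuR R x k : ℂ)

/-- The normal derivative ∂_ν g = ⟨∇g, ν⟩ of a real function at a boundary point. -/
def dnu (R : ℝ) (g : V3 → ℝ) (x : V3) : ℝ := ∑ k, pdR k g x * nuR R x k

/-- The surface integral ∫_{∂Π} F dS = ∫_ℝ ∫₀^{2π} F(R cos θ, R sin θ, t)·R dθ dt. -/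
def surfInt (R : ℝ) (F : V3 → ℂ) : ℂ :=
  ∫ t : ℝ, ∫ θ in (0:ℝ)..(2 * π), F ![R * Real.cos θ, R * Real.sin θ, t] * (R : ℂ)

/-- `f` is `C^k` up to the boundary of the open set `S`: it is `k` times continuously
differentiable on an open neighborhood of the closure of `S`. -/
def UpTo {E : Type*} [NormedAddCommGroup E] [NormedSpace ℝ E]
    (k : ℕ) (S : Set V3) (f : V3 → E) : Prop :=
  ∃ U : Set V3, IsOpen U ∧ closure S ⊆ U ∧ ContDiffOn ℝ k f U

/-- `f` has compact axial support: it vanishes whenever `|x₃| ≥ T` for some `T > 0`. -/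
def AxialSupp {E : Type*} [Zero E] (f : V3 → E) : Prop :=
  ∃ T > 0, ∀ x : V3, T ≤ |x 2| → f x = 0

/-- The matrix W₀(μ)ⱼₖ = μ⁻¹(Δμ)δⱼₖ + μ⁻²(∂ⱼμ)(∂ₖμ) − μ⁻¹∂ⱼ∂ₖμ. -/
def W0 (μ : V3 → ℝ) (x : V3) (j k : Fin 3) : ℝ :=
  (μ x)⁻¹ * lapR μ x * (if j = k then 1 else 0)
    + ((μ x) ^ 2)⁻¹ * pdR j μ x * pdR k μ x
    - (μ x)⁻¹ * pdR j (fun y => pdR k μ y) x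

/-- The matrix W(μ)ⱼₖ = ((2μ)⁻¹Δμ − (4μ²)⁻¹|∇μ|²)δⱼₖ + μ⁻²(∂ⱼμ)(∂ₖμ) − μ⁻¹∂ⱼ∂ₖμ. -/
def Wm (μ : V3 → ℝ) (x : V3) (j k : Fin 3) : ℝ :=
  ((2 * μ x)⁻¹ * lapR μ x - (4 * (μ x) ^ 2)⁻¹ * (∑ i, (pdR i μ x) ^ 2))
      * (if j = k then 1 else 0)
    + ((μ x) ^ 2)⁻¹ * pdR j μ x * pdR k μ x
    - (μ x)⁻¹ * pdR j (fun y => pdR k μ y) x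


lemma pd_mul {a b : V3 → ℂ} {x : V3} (ha : DifferentiableAt ℝ a x) (hb : DifferentiableAt ℝ b x)
    (j : Fin 3) : pd j (fun y => a y * b y) x = a x * pd j b x + b x * pd j a x := by
  simp [pd, fderiv_fun_mul ha hb]

lemma pd_sub {a b : V3 → ℂ} {x : V3} (ha : DifferentiableAt ℝ a x) (hb : DifferentiableAt ℝ b x)
    (j : Fin 3) : pd j (fun y => a y - b y) x = pd j a x - pd j b x := by
  simp [pd, fderiv_fun_sub ha hb]

lemma pd_conj (a : V3 → ℂ) (x : V3) (j : Fin 3) :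
    pd j (fun y => (starRingEnd ℂ) (a y)) x = (starRingEnd ℂ) (pd j a x) := by
  have h := Complex.conjCLE.comp_fderiv (f := a) (x := x)
  have h' : (fun y => (starRingEnd ℂ) (a y)) = Complex.conjCLE ∘ a := by
    ext y; simp
  rw [pd, h', h]
  simp [pd]

/-- A compactly supported `C¹` function has vanishing integral of partial derivatives. -/
lemma integral_pd_eq_zero {g : V3 → ℂ} (hg : ContDiff ℝ 1 g) (hc : HasCompactSupport g)
    (j : Fin 3) : ∫ x, pd j g x = 0 := by
  have hd : Integrable (fun x => fderiv ℝ g x (Pi.single j 1)) :=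
    ((hg.continuous_fderiv one_ne_zero).clm_apply continuous_const).integrable_of_hasCompactSupport
      (hc.fderiv_apply ℝ _)
  have h := integral_mul_fderiv_eq_neg_fderiv_mul_of_integrable (μ := (volume : Measure V3))
    (f := fun _ : V3 => (1 : ℂ)) (g := g) (v := Pi.single j 1) (by simp) (by simpa using hd)
    (by simpa using hg.continuous.integrable_of_hasCompactSupport hc)
    (fun x _ => differentiableAt_const _) (fun x _ => hg.differentiable one_ne_zero x)
  simpa [pd] using h

/-- The closed cylinder of radius `R`. -/
def closedCyl (R : ℝ) : Set V3 := {x | x 0 ^ 2 + x 1 ^ 2 ≤ R ^ 2}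

lemma isOpen_Cyl (R : ℝ) : IsOpen (Cyl R) :=
  isOpen_lt (by fun_prop) continuous_const

lemma Cyl_subset_closedCyl (R : ℝ) : Cyl R ⊆ closedCyl R :=
  Set.ofPred_subset_ofPred.2 fun _ => le_of_lt

lemma closedCyl_subset_closure_Cyl {R : ℝ} (hR : 0 < R) : closedCyl R ⊆ closure (Cyl R) := by
  intro x hx
  have h1 : (1 : ℝ) ∈ closure (Set.Ioo (0 : ℝ) 1) := by
    rw [closure_Ioo zero_ne_one]; simp
  have h := map_mem_closure (f := fun t : ℝ => t • x) (t := Cyl R) (by fun_prop) h1 ?_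
  · simpa using h
  · rintro t ⟨h0, h1⟩
    have hx' : x 0 ^ 2 + x 1 ^ 2 ≤ R ^ 2 := hx
    have ht : t ^ 2 < 1 := by nlinarith
    change (t * x 0) ^ 2 + (t * x 1) ^ 2 < R ^ 2
    have hR2 : 0 < R ^ 2 := by positivity
    calc (t * x 0) ^ 2 + (t * x 1) ^ 2 = t ^ 2 * (x 0 ^ 2 + x 1 ^ 2) := by ring
      _ ≤ t ^ 2 * R ^ 2 := by gcongr
      _ < R ^ 2 := by nlinarith

/-- The closed cylinder of radius `R` truncated at height `T`. -/
def truncCyl (R T : ℝ) : Set V3 := {x | x 0 ^ 2 + x 1 ^ 2 ≤ R ^ 2 ∧ |x 2| ≤ T}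

lemma truncCyl_subset_closedCyl (R T : ℝ) : truncCyl R T ⊆ closedCyl R := fun _ hx => hx.1

lemma isCompact_truncCyl {R : ℝ} (hR : 0 < R) (T : ℝ) : IsCompact (truncCyl R T) := by
  refine Metric.isCompact_of_isClosed_isBounded ?_ ?_
  · have h1 : IsClosed {x : V3 | x 0 ^ 2 + x 1 ^ 2 ≤ R ^ 2} :=
      isClosed_le (by fun_prop) continuous_const
    have h2 : IsClosed {x : V3 | |x 2| ≤ T} := isClosed_le (by fun_prop) continuous_const
    exact h1.inter h2
  · refine (Metric.isBounded_closedBall (x := (0 : V3)) (r := R + |T|)).subset ?_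
    rintro x ⟨h1, h2⟩
    rw [mem_closedBall_zero_iff, pi_norm_le_iff_of_nonneg (by positivity)]
    have h0 : |x 0| ≤ R := abs_le_of_sq_le_sq (by nlinarith [sq_nonneg (x 1)]) hR.le
    have h1 : |x 1| ≤ R := abs_le_of_sq_le_sq (by nlinarith [sq_nonneg (x 0)]) hR.le
    have hT : T ≤ |T| := le_abs_self T
    have hT0 : 0 ≤ |T| := abs_nonneg T
    intro i
    fin_cases i <;> simp only [Real.norm_eq_abs] <;> simp <;> linarith

lemma convex_truncCyl (R T : ℝ) : Convex ℝ (truncCyl R T) := by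
  rintro x ⟨hx1, hx2⟩ y ⟨hy1, hy2⟩ a b ha hb hab
  have key : ∀ i, (a * x i + b * y i) ^ 2 ≤ a * x i ^ 2 + b * y i ^ 2 := fun i => by
    obtain rfl : b = 1 - a := by linarith
    nlinarith [mul_nonneg (mul_nonneg ha hb) (sq_nonneg (x i - y i))]
  refine ⟨?_, ?_⟩
  · change (a * x 0 + b * y 0) ^ 2 + (a * x 1 + b * y 1) ^ 2 ≤ R ^ 2
    have h0 := key 0
    have h1 := key 1
    have h2 : a * (x 0 ^ 2 + x 1 ^ 2) + b * (y 0 ^ 2 + y 1 ^ 2) ≤ a * R ^ 2 + b * R ^ 2 := by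
      gcongr
    rw [← add_mul, hab, one_mul] at h2
    linarith
  · change |a * x 2 + b * y 2| ≤ T
    calc |a * x 2 + b * y 2| ≤ |a * x 2| + |b * y 2| := abs_add_le _ _
      _ = a * |x 2| + b * |y 2| := by rw [abs_mul, abs_mul, abs_of_nonneg ha, abs_of_nonneg hb]
      _ ≤ a * T + b * T := by gcongr
      _ = T := by rw [← add_mul, hab, one_mul]

/-- A function continuous on the closed cylinder and vanishing far away along the axis is
integrable on the cylinder. -/
lemma integrableOn_Cyl {R T : ℝ} (hR : 0 < R) {g : V3 → ℂ} (hg : ContinuousOn g (closedCyl R))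
    (h0 : ∀ x ∈ Cyl R, T < |x 2| → g x = 0) : IntegrableOn g (Cyl R) := by
  have h := (hg.mono (truncCyl_subset_closedCyl R T)).integrableOn_compact (μ := volume)
    (isCompact_truncCyl hR T)
  refine h.of_forall_sdiff_eq_zero (isOpen_Cyl R).measurableSet fun x hx => h0 x hx.1 ?_
  by_contra hT
  exact hx.2 ⟨Cyl_subset_closedCyl R hx.1, not_lt.1 hT⟩

/-- Each point of the truncated cylinder is controlled by its distance to the lateral boundary. -/
lemma exists_bCyl_near {R T : ℝ} (hR : 0 < R) {x : V3} (hx : x ∈ truncCyl R T) :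
    ∃ y ∈ truncCyl R T, y ∈ bCyl R ∧ ‖x - y‖ ≤ (R ^ 2 - x 0 ^ 2 - x 1 ^ 2) / R := by
  obtain ⟨hx1, hx2⟩ := hx
  rcases eq_or_ne (x 0 ^ 2 + x 1 ^ 2) 0 with h0 | h0
  · have hx0 : x 0 = 0 := by nlinarith [sq_nonneg (x 0), sq_nonneg (x 1)]
    have hx1 : x 1 = 0 := by nlinarith [sq_nonneg (x 0), sq_nonneg (x 1)]
    refine ⟨![R, 0, x 2], ⟨by simp, by simpa using hx2⟩, by simp [bCyl], ?_⟩
    rw [pi_norm_le_iff_of_nonneg (by rw [hx0, hx1]; simp; positivity)]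
    have hRR : R ^ 2 / R = R := by field_simp
    intro i
    fin_cases i <;> simp [hx0, hx1, hRR, abs_of_pos hR, hR.le]
  · set r := √(x 0 ^ 2 + x 1 ^ 2) with hr
    have hr0 : 0 < r := Real.sqrt_pos.2 (lt_of_le_of_ne (by positivity) h0.symm)
    have hr2 : r ^ 2 = x 0 ^ 2 + x 1 ^ 2 := Real.sq_sqrt (by positivity)
    have hrR : r ≤ R := abs_le_of_sq_le_sq' (by rw [hr2]; exact hx1) hR.le |>.2
    have hy : (R / r * x 0) ^ 2 + (R / r * x 1) ^ 2 = R ^ 2 := by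
      rw [mul_pow, mul_pow, ← mul_add, ← hr2]; field_simp
    have hle : R - r ≤ (R ^ 2 - x 0 ^ 2 - x 1 ^ 2) / R := by
      rw [le_div_iff₀ hR]; nlinarith
    have hco : ∀ i, x i ^ 2 ≤ r ^ 2 → |x i - R / r * x i| ≤ R - r := fun i hi => by
      have h1 : |x i| ≤ r := abs_le_of_sq_le_sq hi hr0.le
      have h2 : 0 ≤ R / r - 1 := by rw [sub_nonneg, le_div_iff₀ hr0]; linarith
      calc |x i - R / r * x i| = (R / r - 1) * |x i| := by
            rw [show x i - R / r * x i = -((R / r - 1) * x i) by ring, abs_neg, abs_mul,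
              abs_of_nonneg h2]
        _ ≤ (R / r - 1) * r := by gcongr
        _ = R - r := by field_simp
    refine ⟨![R / r * x 0, R / r * x 1, x 2], ⟨by simpa using hy.le, by simpa using hx2⟩,
      by simpa [bCyl] using hy, ?_⟩
    refine le_trans ?_ hle
    rw [pi_norm_le_iff_of_nonneg (by linarith)]
    intro i
    fin_cases i
    · simpa using hco 0 (by nlinarith [sq_nonneg (x 1)])
    · simpa using hco 1 (by nlinarith [sq_nonneg (x 0)])
    · simpa using hrR

/-- A `C¹` function vanishing on the lateral boundary vanishes there at least linearly. -/
lemma exists_le_of_eq_zero_on_bCyl {R T : ℝ} (hR : 0 < R) {U : Set V3} (hU : IsOpen U)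
    (hRU : closedCyl R ⊆ U) {q : V3 → ℂ} (hq : ContDiffOn ℝ 1 q U)
    (h0 : ∀ x ∈ bCyl R, q x = 0) :
    ∃ C, 0 ≤ C ∧ ∀ x ∈ truncCyl R T, ‖q x‖ ≤ C * (R ^ 2 - x 0 ^ 2 - x 1 ^ 2) := by
  have hK := (truncCyl_subset_closedCyl R T).trans hRU
  obtain ⟨C, hC⟩ := (isCompact_truncCyl hR T).exists_bound_of_continuousOn
    ((hq.continuousOn_fderiv_of_isOpen hU le_rfl).mono hK)
  refine ⟨|C| / R, by positivity, fun x hx => ?_⟩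
  obtain ⟨y, hy, hyb, hxy⟩ := exists_bCyl_near hR hx
  have h := (convex_truncCyl R T).norm_image_sub_le_of_norm_fderiv_le (𝕜 := ℝ) (f := q) (C := |C|)
    (fun z hz => (hq.differentiableOn one_ne_zero).differentiableAt (hU.mem_nhds (hK hz)))
    (fun z hz => (hC z hz).trans (le_abs_self C)) hy hx
  rw [h0 y hyb, sub_zero] at h
  calc ‖q x‖ ≤ |C| * ‖x - y‖ := h
    _ ≤ |C| * ((R ^ 2 - x 0 ^ 2 - x 1 ^ 2) / R) := by gcongr
    _ = |C| / R * (R ^ 2 - x 0 ^ 2 - x 1 ^ 2) := by ring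

lemma exists_bound_deriv_smoothTransition :
    ∃ M, ∀ t : ℝ, |deriv Real.smoothTransition t * (t + 1)| ≤ M := by
  have hc : Continuous fun t : ℝ => deriv Real.smoothTransition t * (t + 1) :=
    ((Real.smoothTransition.contDiff (n := 1)).continuous_deriv le_rfl).mul (by fun_prop)
  refine hc.bounded_above_of_compact_support ?_
  refine HasCompactSupport.intro (isCompact_Icc (a := (0 : ℝ)) (b := 1)) fun t ht => ?_
  have h : deriv Real.smoothTransition t = 0 := by
    rcases lt_or_ge t 0 with h | h
    · have : Real.smoothTransition =ᶠ[nhds t] fun _ => 0 := by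
        filter_upwards [Iio_mem_nhds h] with s hs
        exact Real.smoothTransition.zero_of_nonpos (le_of_lt hs)
      rw [this.deriv_eq]; simp
    · have h1 : 1 < t := by by_contra h1; exact ht ⟨h, not_lt.1 h1⟩
      have : Real.smoothTransition =ᶠ[nhds t] fun _ => 1 := by
        filter_upwards [Ioi_mem_nhds h1] with s hs
        exact Real.smoothTransition.one_of_one_le (le_of_lt hs)
      rw [this.deriv_eq]; simp
  simp [h]

/-- A smooth cutoff, vanishing near the lateral boundary of the cylinder of radius `R` and
increasing to its indicator function as `c → ∞`. -/
def cutoff (R c : ℝ) (x : V3) : ℂ :=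
  (Real.smoothTransition (c * (R ^ 2 - x 0 ^ 2 - x 1 ^ 2) - 1) : ℝ)

lemma contDiff_cutoff (R c : ℝ) : ContDiff ℝ 1 (cutoff R c) := by
  have h : ContDiff ℝ 1 fun x : V3 => c * (R ^ 2 - x 0 ^ 2 - x 1 ^ 2) - 1 := by fun_prop
  exact Complex.ofRealCLM.contDiff.comp (Real.smoothTransition.contDiff.comp h)

lemma cutoff_eq_zero {R c : ℝ} {x : V3} (h : c * (R ^ 2 - x 0 ^ 2 - x 1 ^ 2) ≤ 1) :
    cutoff R c x = 0 := by
  rw [cutoff, Real.smoothTransition.zero_of_nonpos (by linarith), Complex.ofReal_zero]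

lemma cutoff_eq_one {R c : ℝ} {x : V3} (h : 2 ≤ c * (R ^ 2 - x 0 ^ 2 - x 1 ^ 2)) :
    cutoff R c x = 1 := by
  rw [cutoff, Real.smoothTransition.one_of_one_le (by linarith), Complex.ofReal_one]

lemma norm_cutoff_le (R c : ℝ) (x : V3) : ‖cutoff R c x‖ ≤ 1 := by
  rw [cutoff, Complex.norm_real, Real.norm_of_nonneg (Real.smoothTransition.nonneg _)]
  exact Real.smoothTransition.le_one _

lemma sum_pd_cutoff_mul (R c : ℝ) (x : V3) (z : C3) :
    ∑ j, pd j (cutoff R c) x * z j =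
      -(2 * c * deriv Real.smoothTransition (c * (R ^ 2 - x 0 ^ 2 - x 1 ^ 2) - 1) : ℝ) *
        (x 0 * z 0 + x 1 * z 1) := by
  have hp : ∀ i : Fin 3, HasFDerivAt (fun y : V3 => y i) (ContinuousLinearMap.proj (R := ℝ) i) x :=
    fun i => hasFDerivAt_apply i x
  have hs := ((((hp 0).pow 2).const_sub (R ^ 2)).sub ((hp 1).pow 2)).const_mul c |>.sub_const 1
  have hφ := ((Real.smoothTransition.contDiff (n := 1)).differentiable one_ne_zero
    (c * (R ^ 2 - x 0 ^ 2 - x 1 ^ 2) - 1)).hasDerivAt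
  have h := Complex.ofRealCLM.hasFDerivAt.comp x (hφ.comp_hasFDerivAt x hs)
  have h' : fderiv ℝ (cutoff R c) x = _ := h.fderiv
  simp only [pd, h', Fin.sum_univ_three]
  simp
  ring

lemma vdiv_cutoff_mul {R c : ℝ} {w : V3 → C3} {x : V3} (hw : DifferentiableAt ℝ w x) :
    vdiv (fun y => cutoff R c y • w y) x = cutoff R c x * vdiv w x
      - (2 * c * deriv Real.smoothTransition (c * (R ^ 2 - x 0 ^ 2 - x 1 ^ 2) - 1) : ℝ) *
        (x 0 * w x 0 + x 1 * w x 1) := by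
  have h : ∀ j, pd j (fun y => cutoff R c y * w y j) x =
      cutoff R c x * pd j (fun y => w y j) x + pd j (cutoff R c) x * w x j := fun j => by
    rw [pd_mul ((contDiff_cutoff R c).differentiable one_ne_zero x) (differentiableAt_pi.1 hw j)]
    ring
  simp only [vdiv, Pi.smul_apply, smul_eq_mul, h, Finset.sum_add_distrib, ← Finset.mul_sum]
  rw [sum_pd_cutoff_mul]
  ring

lemma pd_eq_zero_of_eventuallyEq {g : V3 → ℂ} {x : V3} (h : g =ᶠ[nhds x] 0) (j : Fin 3) :
    pd j g x = 0 := by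
  simp [pd, h.fderiv_eq]

lemma contDiff_cutoff_smul {R c : ℝ} (hc : 0 < c) {U : Set V3} (hU : IsOpen U)
    (hRU : closedCyl R ⊆ U) {w : V3 → C3} (hw : ContDiffOn ℝ 1 w U) :
    ContDiff ℝ 1 fun y => cutoff R c y • w y := by
  rw [contDiff_iff_contDiffAt]
  intro x
  by_cases hx : x ∈ closedCyl R
  · exact (contDiff_cutoff R c).contDiffAt.smul (hw.contDiffAt (hU.mem_nhds (hRU hx)))
  · have hx' : R ^ 2 < x 0 ^ 2 + x 1 ^ 2 := not_le.1 hx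
    have h : (fun y => cutoff R c y • w y) =ᶠ[nhds x] fun _ => 0 := by
      have hev : ∀ᶠ y : V3 in nhds x, R ^ 2 < y 0 ^ 2 + y 1 ^ 2 :=
        (isOpen_lt continuous_const (by fun_prop)).mem_nhds hx'
      filter_upwards [hev] with y hy
      rw [cutoff_eq_zero (by nlinarith), zero_smul]
    exact contDiffAt_const.congr_of_eventuallyEq h

lemma continuousOn_pd {U : Set V3} (hU : IsOpen U) {w : V3 → C3} (hw : ContDiffOn ℝ 1 w U)
    (i j : Fin 3) : ContinuousOn (pd j fun y => w y i) U :=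
  ((contDiffOn_pi.1 hw i).continuousOn_fderiv_of_isOpen hU le_rfl).clm_apply continuousOn_const

/-- Divergence theorem on the cylinder for fields tangential to the lateral boundary. -/
theorem integral_vdiv_eq_zero {R : ℝ} (hR : 0 < R) {w : V3 → C3} (hw : UpTo 1 (Cyl R) w)
    (hws : AxialSupp w) (hb : ∀ x ∈ bCyl R, x 0 * w x 0 + x 1 * w x 1 = 0) :
    ∫ x in Cyl R, vdiv w x = 0 := by
  obtain ⟨U, hU, hcU, hw⟩ := hw
  obtain ⟨T, -, hT⟩ := hws
  have hRU := (closedCyl_subset_closure_Cyl hR).trans hcU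
  have hK := isCompact_truncCyl hR T
  have hKU := (truncCyl_subset_closedCyl R T).trans hRU
  have hwi := contDiffOn_pi.1 hw
  obtain ⟨L, hL0, hL⟩ := exists_le_of_eq_zero_on_bCyl (T := T) hR hU hRU
    (q := fun x => x 0 * w x 0 + x 1 * w x 1)
    (by
      have hx : ∀ i : Fin 3, ContDiff ℝ 1 fun x : V3 => (x i : ℂ) := fun i =>
        Complex.ofRealCLM.contDiff.comp (contDiff_apply ℝ ℝ i)
      exact ((hx 0).contDiffOn.mul (hwi 0)).add ((hx 1).contDiffOn.mul (hwi 1))) hb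
  obtain ⟨M, hM⟩ := exists_bound_deriv_smoothTransition
  have hM0 : 0 ≤ M := (abs_nonneg _).trans (hM 0)
  obtain ⟨D, hD⟩ := hK.exists_bound_of_continuousOn
    ((continuousOn_finsetSum Finset.univ fun j _ => continuousOn_pd hU hw j j).mono hKU)
  have hcont : ∀ n : ℕ, ContDiff ℝ 1 fun y => cutoff R (n + 1) y • w y := fun n =>
    contDiff_cutoff_smul (by positivity) hU hRU hw
  have hsupp : ∀ n : ℕ, ∀ x ∉ truncCyl R T, cutoff R (n + 1) x • w x = 0 := fun n x hx => by
    by_cases h1 : x 0 ^ 2 + x 1 ^ 2 ≤ R ^ 2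
    · have h2 : T < |x 2| := by by_contra h2; exact hx ⟨h1, not_lt.1 h2⟩
      rw [hT x h2.le, smul_zero]
    · have hn : (0 : ℝ) < n + 1 := by positivity
      rw [cutoff_eq_zero (by nlinarith), zero_smul]
  have hpd0 : ∀ n : ℕ, ∀ x, x ∉ truncCyl R T ∨ x ∉ Cyl R →
      vdiv (fun y => cutoff R (n + 1) y • w y) x = 0 := fun n x hx => by
    have hn : (0 : ℝ) < n + 1 := by positivity
    have hev : ∀ᶠ y in nhds x, cutoff R (n + 1) y • w y = 0 := by
      rcases hx with hx | hx
      · filter_upwards [hK.isClosed.isOpen_compl.mem_nhds hx] with y hy using hsupp n y hy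
      · have hx' : ((n : ℝ) + 1) * (R ^ 2 - x 0 ^ 2 - x 1 ^ 2) < 1 := by
          have : R ^ 2 ≤ x 0 ^ 2 + x 1 ^ 2 := not_lt.1 hx
          nlinarith
        have hev : ∀ᶠ y : V3 in nhds x, ((n : ℝ) + 1) * (R ^ 2 - y 0 ^ 2 - y 1 ^ 2) < 1 :=
          (isOpen_lt (by fun_prop) continuous_const).mem_nhds hx'
        filter_upwards [hev] with y hy
        rw [cutoff_eq_zero hy.le, zero_smul]
    refine Finset.sum_eq_zero fun j _ => pd_eq_zero_of_eventuallyEq ?_ j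
    filter_upwards [hev] with y hy using congrFun hy j
  have hint : ∀ n : ℕ, ∫ x, vdiv (fun y => cutoff R (n + 1) y • w y) x = 0 := fun n => by
    have hc : ∀ j, HasCompactSupport fun y => (cutoff R (n + 1) y • w y) j := fun j =>
      HasCompactSupport.intro hK fun x hx => congrFun (hsupp n x hx) j
    have hcd := contDiff_pi.1 (hcont n)
    unfold vdiv
    rw [integral_finsetSum]
    · exact Finset.sum_eq_zero fun j _ => integral_pd_eq_zero (hcd j) (hc j) j
    · exact fun j _ => (((hcd j).continuous_fderiv one_ne_zero).clm_apply
        continuous_const).integrable_of_hasCompactSupport ((hc j).fderiv_apply ℝ _)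
  have hlim : Filter.Tendsto (fun n : ℕ => ∫ x, vdiv (fun y => cutoff R (n + 1) y • w y) x)
      Filter.atTop (nhds (∫ x, (Cyl R).indicator (vdiv w) x)) := by
    refine tendsto_integral_of_dominated_convergence
      ((truncCyl R T).indicator fun _ => D + 2 * L * M) (fun n => ?_) ?_ (fun n => ?_) ?_
    · refine Continuous.aestronglyMeasurable (continuous_finsetSum _ fun j _ => ?_)
      exact ((contDiff_pi.1 (hcont n) j).continuous_fderiv one_ne_zero).clm_apply continuous_const
    · exact (integrable_indicator_iff hK.measurableSet).2
        (integrableOn_const hK.measure_lt_top.ne)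
    · refine Filter.Eventually.of_forall fun x => ?_
      by_cases hxK : x ∈ truncCyl R T
      swap
      · rw [hpd0 n x (Or.inl hxK), Set.indicator_of_notMem hxK, norm_zero]
      rw [Set.indicator_of_mem hxK]
      have hd := hw.differentiableOn one_ne_zero |>.differentiableAt (hU.mem_nhds (hKU hxK))
      rw [vdiv_cutoff_mul hd]
      set s := R ^ 2 - x 0 ^ 2 - x 1 ^ 2 with hs
      have hs0 : 0 ≤ s := by have := hxK.1; linarith
      have h1 : ‖cutoff R (n + 1) x * vdiv w x‖ ≤ D := by
        rw [norm_mul]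
        exact (mul_le_of_le_one_left (norm_nonneg _) (norm_cutoff_le _ _ _)).trans (hD x hxK)
      have h2 := hL x hxK
      have h3 := hM ((n + 1) * s - 1)
      rw [sub_add_cancel, abs_mul, abs_of_nonneg (by positivity : 0 ≤ ((n : ℝ) + 1) * s)] at h3
      refine (norm_sub_le _ _).trans (add_le_add h1 ?_)
      rw [norm_mul, Complex.norm_real, Real.norm_eq_abs, abs_mul,
        abs_of_nonneg (by positivity : 0 ≤ 2 * ((n : ℝ) + 1))]
      set d := |deriv Real.smoothTransition ((n + 1) * s - 1)|
      calc 2 * ((n : ℝ) + 1) * d * ‖(x 0 : ℂ) * w x 0 + x 1 * w x 1‖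
          ≤ 2 * ((n : ℝ) + 1) * d * (L * s) := by gcongr
        _ = 2 * L * (d * ((n + 1) * s)) := by ring
        _ ≤ 2 * L * M := by gcongr
    · refine Filter.Eventually.of_forall fun x => ?_
      by_cases hx : x ∈ Cyl R
      swap
      · simp only [hpd0 _ x (Or.inr hx), Set.indicator_of_notMem hx, tendsto_const_nhds]
      rw [Set.indicator_of_mem hx]
      have hs : 0 < R ^ 2 - x 0 ^ 2 - x 1 ^ 2 := by
        have : x 0 ^ 2 + x 1 ^ 2 < R ^ 2 := hx
        linarith
      obtain ⟨N, hN⟩ := exists_nat_gt (2 / (R ^ 2 - x 0 ^ 2 - x 1 ^ 2))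
      refine tendsto_const_nhds.congr' ?_
      filter_upwards [Filter.eventually_ge_atTop N] with n hn
      have hn' : 2 < ((n : ℝ) + 1) * (R ^ 2 - x 0 ^ 2 - x 1 ^ 2) := by
        rw [div_lt_iff₀ hs] at hN
        have : (N : ℝ) ≤ n := by exact_mod_cast hn
        nlinarith
      have hev : ∀ᶠ y : V3 in nhds x, 2 < ((n : ℝ) + 1) * (R ^ 2 - y 0 ^ 2 - y 1 ^ 2) :=
        (isOpen_lt continuous_const (by fun_prop)).mem_nhds hn'
      refine Finset.sum_congr rfl fun j _ => ?_
      have : (fun y => w y j) =ᶠ[nhds x] fun y => (cutoff R (n + 1) y • w y) j := by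
        filter_upwards [hev] with y hy
        rw [cutoff_eq_one hy.le, one_smul]
      rw [pd, pd, this.fderiv_eq]
  rw [← integral_indicator (isOpen_Cyl R).measurableSet]
  refine tendsto_nhds_unique hlim ?_
  simp only [hint, tendsto_const_nhds]

lemma vdiv_cross_conj {a b : V3 → C3} {x : V3} (ha : DifferentiableAt ℝ a x)
    (hb : DifferentiableAt ℝ b x) :
    vdiv (fun y => cross (a y) fun i => (starRingEnd ℂ) (b y i)) x =
      hinner (vcurl a x) (b x) - hinner (a x) (vcurl b x) := by
  have ha' := differentiableAt_pi.1 ha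
  have hb' : ∀ i, DifferentiableAt ℝ (fun y => (starRingEnd ℂ) (b y i)) x := fun i =>
    Complex.conjCLE.differentiableAt.comp x (differentiableAt_pi.1 hb i)
  have h : ∀ i j k l m : Fin 3,
      pd m (fun y => a y i * (starRingEnd ℂ) (b y j) - a y k * (starRingEnd ℂ) (b y l)) x =
      a x i * (starRingEnd ℂ) (pd m (fun y => b y j) x)
        + (starRingEnd ℂ) (b x j) * pd m (fun y => a y i) x
        - (a x k * (starRingEnd ℂ) (pd m (fun y => b y l) x)
        + (starRingEnd ℂ) (b x l) * pd m (fun y => a y k) x) := fun i j k l m => by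
    rw [pd_sub ((ha' i).fun_mul (hb' j)) ((ha' k).fun_mul (hb' l)), pd_mul (ha' i) (hb' j),
      pd_mul (ha' k) (hb' l), pd_conj, pd_conj]
  simp only [vdiv, cross, hinner, vcurl, Fin.sum_univ_three, Matrix.cons_val, h, map_sub]
  ring

/-- Integration by parts for the curl on the cylinder, for a field with vanishing tangential
boundary values. -/
theorem integral_hinner_vcurl {R : ℝ} (hR : 0 < R) {u f : V3 → C3} (hu : UpTo 1 (Cyl R) u)
    (hus : AxialSupp u) (hf : UpTo 1 (Cyl R) f)
    (hubc : ∀ x ∈ bCyl R, ∀ i, u x i = ncomp R x (u x) * (nuR R x i : ℂ)) :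
    ∫ x in Cyl R, (hinner (vcurl u x) (f x) - hinner (u x) (vcurl f x)) = 0 := by
  obtain ⟨U, hU, hcU, hu⟩ := hu
  obtain ⟨V, hV, hcV, hf⟩ := hf
  obtain ⟨T, hT0, hT⟩ := hus
  have hdiff : ∀ x ∈ Cyl R, vdiv (fun y => cross (u y) fun i => (starRingEnd ℂ) (f y i)) x =
      hinner (vcurl u x) (f x) - hinner (u x) (vcurl f x) := fun x hx =>
    vdiv_cross_conj
      ((hu.differentiableOn one_ne_zero).differentiableAt (hU.mem_nhds (hcU (subset_closure hx))))
      ((hf.differentiableOn one_ne_zero).differentiableAt (hV.mem_nhds (hcV (subset_closure hx))))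
  rw [← setIntegral_congr_fun (isOpen_Cyl R).measurableSet hdiff]
  refine integral_vdiv_eq_zero hR ⟨U ∩ V, hU.inter hV, Set.subset_inter hcU hcV, ?_⟩
    ⟨T, hT0, fun x hx => ?_⟩ fun x hx => ?_
  · have hu' := contDiffOn_pi.1 (hu.mono (Set.inter_subset_left (t := V)))
    have hf' : ∀ i, ContDiffOn ℝ 1 (fun y => (starRingEnd ℂ) (f y i)) (U ∩ V) := fun i =>
      Complex.conjCLE.contDiff.comp_contDiffOn
        (contDiffOn_pi.1 (hf.mono (Set.inter_subset_right (s := U))) i)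
    refine contDiffOn_pi.2 fun i => ?_
    fin_cases i
    · exact ((hu' 1).mul (hf' 2)).sub ((hu' 2).mul (hf' 1))
    · exact ((hu' 2).mul (hf' 0)).sub ((hu' 0).mul (hf' 2))
    · exact ((hu' 0).mul (hf' 1)).sub ((hu' 1).mul (hf' 0))
  · simp only [hT x hx]
    ext i
    fin_cases i <;> simp [cross]
  · have h0 := hubc x hx 0
    have h1 := hubc x hx 1
    have h2 := hubc x hx 2
    simp only [nuR, Matrix.cons_val, Complex.ofReal_zero, Complex.ofReal_div, mul_zero]
      at h0 h1 h2
    simp only [cross, Matrix.cons_val]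
    rw [h2]
    generalize ncomp R x (u x) = c at h0 h1
    rw [h0, h1]
    ring

lemma UpTo.continuousOn_vcurl {R : ℝ} (hR : 0 < R) {f : V3 → C3} (hf : UpTo 1 (Cyl R) f)
    (i : Fin 3) : ContinuousOn (fun x => vcurl f x i) (closedCyl R) := by
  obtain ⟨U, hU, hcU, hf⟩ := hf
  have h := fun i j => (continuousOn_pd hU hf i j).mono
    ((closedCyl_subset_closure_Cyl hR).trans hcU)
  fin_cases i
  · exact (h 2 1).sub (h 1 2)
  · exact (h 0 2).sub (h 2 0)
  · exact (h 1 0).sub (h 0 1)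

lemma UpTo.continuousOn {E : Type*} [NormedAddCommGroup E] [NormedSpace ℝ E] {R : ℝ} {k : ℕ}
    (hR : 0 < R) {f : V3 → E} (hf : UpTo k (Cyl R) f) : ContinuousOn f (closedCyl R) := by
  obtain ⟨U, -, hcU, hf⟩ := hf
  exact hf.continuousOn.mono ((closedCyl_subset_closure_Cyl hR).trans hcU)

lemma continuousOn_hinner {S : Set V3} {a b : V3 → C3} (ha : ∀ i, ContinuousOn (fun x => a x i) S)
    (hb : ∀ i, ContinuousOn (fun x => b x i) S) : ContinuousOn (fun x => hinner (a x) (b x)) S :=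
  continuousOn_finsetSum _ fun i _ =>
    (ha i).mul (Complex.continuous_conj.comp_continuousOn (hb i))

lemma hinner_smul_left (c : ℂ) (a b : C3) : hinner (c • a) b = c * hinner a b := by
  simp [hinner, Finset.mul_sum, mul_assoc]

lemma hinner_zero_left (b : C3) : hinner 0 b = 0 := by simp [hinner]

/-- for an eigenfunction pair (u, v) of the Maxwell system, the quadratic
form identity ∫ ε⁻¹⟨curl v, curl f⟩ = λ²∫ μ⟨v, f⟩ holds for all test fields f that are
C¹ up to the boundary. -/
theorem statement14 (R : ℝ) (hR : 0 < R) (ε μ : V3 → ℝ) (lam : ℝ) (u v : V3 → C3)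
    (hε : UpTo 0 (Cyl R) ε) (hμ : UpTo 0 (Cyl R) μ)
    (hεpos : ∀ x ∈ closure (Cyl R), 0 < ε x) (hμpos : ∀ x ∈ closure (Cyl R), 0 < μ x)
    (hu : UpTo 1 (Cyl R) u) (hv : UpTo 1 (Cyl R) v)
    (hus : AxialSupp u) (hvs : AxialSupp v)
    (hequ : ∀ x ∈ Cyl R, vcurl u x = (Complex.I * (lam : ℂ) * (μ x : ℂ)) • v x)
    (heqv : ∀ x ∈ Cyl R, vcurl v x = (-(Complex.I * (lam : ℂ) * (ε x : ℂ))) • u x)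
    (hubc : ∀ x ∈ bCyl R, ∀ i, u x i = ncomp R x (u x) * (nuR R x i : ℂ))
    (f : V3 → C3) (hf : UpTo 1 (Cyl R) f) :
    ∫ x in Cyl R, (((ε x)⁻¹ : ℝ) : ℂ) * hinner (vcurl v x) (vcurl f x)
      = (lam : ℂ) ^ 2 * ∫ x in Cyl R, (μ x : ℂ) * hinner (v x) (f x) := by
  have hparts := integral_hinner_vcurl hR hu hus hf hubc
  obtain ⟨T, -, hT⟩ := hus
  obtain ⟨S, -, hS⟩ := hvs
  have hU : IntegrableOn (fun x => hinner (u x) (vcurl f x)) (Cyl R) :=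
    integrableOn_Cyl (T := T) hR
      (continuousOn_hinner (continuousOn_pi.1 (hu.continuousOn hR)) (hf.continuousOn_vcurl hR))
      fun x _ hx => by rw [hT x hx.le, hinner_zero_left]
  have hV : IntegrableOn (fun x => hinner (vcurl u x) (f x)) (Cyl R) :=
    integrableOn_Cyl (T := S) hR
      (continuousOn_hinner (hu.continuousOn_vcurl hR) (continuousOn_pi.1 (hf.continuousOn hR)))
      fun x hx hxS => by rw [hequ x hx, hS x hxS.le, smul_zero, hinner_zero_left]
  rw [integral_sub hV hU, sub_eq_zero] at hparts
  have hmeas := (isOpen_Cyl R).measurableSet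
  calc ∫ x in Cyl R, (((ε x)⁻¹ : ℝ) : ℂ) * hinner (vcurl v x) (vcurl f x)
      = ∫ x in Cyl R, -(Complex.I * lam) * hinner (u x) (vcurl f x) := by
        refine setIntegral_congr_fun hmeas fun x hx => ?_
        have hεx : (ε x : ℂ) ≠ 0 := by exact_mod_cast (hεpos x (subset_closure hx)).ne'
        simp only [heqv x hx, hinner_smul_left, Complex.ofReal_inv]
        field_simp
    _ = ∫ x in Cyl R, -(Complex.I * lam) * hinner (vcurl u x) (f x) := by
        rw [integral_const_mul, integral_const_mul, hparts]
    _ = ∫ x in Cyl R, (lam : ℂ) ^ 2 * ((μ x : ℂ) * hinner (v x) (f x)) := by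
        refine setIntegral_congr_fun hmeas fun x hx => ?_
        simp only [hequ x hx, hinner_smul_left]
        linear_combination (-(lam : ℂ) ^ 2 * μ x * hinner (v x) (f x)) * Complex.I_sq
    _ = (lam : ℂ) ^ 2 * ∫ x in Cyl R, (μ x : ℂ) * hinner (v x) (f x) := integral_const_mul _ _

end
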